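/- Convergence of stochastic majorization-minimization (SMM): Let Θ ⊂ ℝ^K be a nonempty compact convex set, n ≥ 1, R, ρ, L > 0, and let f^{(1)}, …, f^{(n)} : ℝ^K → ℝ be R-Lipschitz on ℝ^K and bounded on Θ, such that for every i and all θ, θ' ∈ ℝ^K the directional derivatives ∇f^{(i)}(θ, θ'−θ) and ∇f̄(θ, θ'−θ) exist, where f̄ = (1/n)∑_{i=1}^n f^{(i)}. Let u ∈ (3/4, 1) and w_t = t^{−u}. On a probability space with filtration (F_t)_{t≥0}, let (i_t)_{t≥1} be i.i.d. uniform on {1,…,n} with i_t F_t-measurable and independent of F_{t−1}, and set f_t = f^{(i_t)}. Let K₀ ⊂ ℝ^P be compact and ĝ : K₀ × ℝ^K → ℝ jointly continuous. Suppose θ₀ ∈ Θ is deterministic and that for every t ≥ 1 there are F_t-measurable random objects g_t (a function ℝ^K → ℝ), κ_t ∈ K₀ and θ_t ∈ Θ such that, almost surely: g_t ∈ S_{ρ,L}(f_t, θ_{t−1}); the aggregate ḡ_t := (1−w_t)ḡ_{t−1} + w_t g_t (with ḡ_1 = g_1, consistent since w_1 = 1) satisfies ḡ_t = ĝ(κ_t,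 ·) on ℝ^K; and θ_t is a minimizer of ḡ_t over Θ. Then, with probability one, the sequence (f̄(θ_t))_{t≥1} converges, and every limit point θ_∞ of (θ_t)_t is a stationary point of f̄ over Θ: for all θ ∈ Θ, ∇f̄(θ_∞, θ − θ_∞) ≥ 0. -/

import Mathlib

open MeasureTheory

/-- `f` has directional derivative `d` at `θ` in direction `δ`. -/
def HasDirDeriv {E : Type*} [AddCommGroup E] [Module ℝ E]
    (f : E → ℝ) (θ δ : E) (d : ℝ) : Prop :=
  Filter.Tendsto (fun s : ℝ => (f (θ + s • δ) - f θ) / s)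
    (nhdsWithin 0 (Set.Ioi 0)) (nhds d)

/-- `g ∈ S_{ρ,L}(f, θ)`: first-order surrogate of `f` at `θ`, i.e. `g` is ρ-strongly convex,
majorizes `f` on `Θ`, is tight at `θ`, and `g − f` is differentiable with `L`-Lipschitz
gradient vanishing at `θ`. -/
def IsSurrogate {K : ℕ} (Θ : Set (EuclideanSpace ℝ (Fin K))) (ρ L : ℝ)
    (f g : EuclideanSpace ℝ (Fin K) → ℝ) (θ : EuclideanSpace ℝ (Fin K)) : Prop :=
  ConvexOn ℝ Set.univ (fun x => g x - ρ / 2 * ‖x‖ ^ 2) ∧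
  (∀ x ∈ Θ, f x ≤ g x) ∧
  g θ = f θ ∧
  Differentiable ℝ (fun x => g x - f x) ∧
  (∀ x y, ‖gradient (fun z => g z - f z) x - gradient (fun z => g z - f z) y‖ ≤
    L * ‖x - y‖) ∧
  gradient (fun z => g z - f z) θ = 0

open Filter Topology Finset in
theorem rs_lemma (Ψ a b : ℕ → ℝ) (hb : ∀ t, 0 ≤ b t) (ha : ∀ t, 0 ≤ a t) (has : Summable a)
    (m : ℝ) (hm : ∀ t, m ≤ Ψ t) (h : ∀ t, Ψ (t+1) ≤ Ψ t - b t + a t) :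
    (∃ l, Tendsto Ψ atTop (𝓝 l)) ∧ Summable b := by
  have hS : ∀ t, ∑ i ∈ range t, a i ≤ ∑' i, a i := fun t =>
    has.sum_le_tsum _ (fun i _ => ha i)
  constructor
  · have hanti : Antitone (fun t => Ψ t - ∑ i ∈ range t, a i) := by
      apply antitone_nat_of_succ_le
      intro t
      rw [sum_range_succ]
      linarith [h t, hb t]
    have hbd : BddBelow (Set.range (fun t => Ψ t - ∑ i ∈ range t, a i)) := by
      refine ⟨m - ∑' i, a i, ?_⟩
      rintro _ ⟨t, rfl⟩
      simp only
      linarith [hm t, hS t]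
    have h1 := tendsto_atTop_ciInf hanti hbd
    have h2 := h1.add has.hasSum.tendsto_sum_nat
    exact ⟨_, h2.congr (fun t => by simp)⟩
  · apply summable_of_sum_range_le (c := Ψ 0 - m + ∑' i, a i) hb
    intro t
    have : Ψ t + ∑ i ∈ range t, b i ≤ Ψ 0 + ∑ i ∈ range t, a i := by
      induction t with
      | zero => simp
      | succ k ih => rw [sum_range_succ, sum_range_succ]; linarith [h k]
    linarith [hm t, hS t]

open Filter Topology Finset in
theorem slow_lemma (w b : ℕ → ℝ) (C : ℝ) (hC : 0 ≤ C) (hw : ∀ t, 0 ≤ w t)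
    (hww : Summable (fun t => w t ^ 2)) (hwd : ¬ Summable w)
    (hb : ∀ t, 0 ≤ b t) (hs : Summable (fun t => w t * b t))
    (hd : ∀ t, |b (t+1) - b t| ≤ C * w t) : Tendsto b atTop (𝓝 0) := by
  have hc : ∀ t, dist (b t ^ 2) (b (t+1) ^ 2) ≤ 2 * C * (w t * b t) + C ^ 2 * w t ^ 2 := by
    intro t
    rw [dist_comm, Real.dist_eq]
    have h1 := hd t
    have h2 : b (t+1) ^ 2 - b t ^ 2 = (b (t+1) - b t) * (b (t+1) + b t) := by ring
    rw [h2, abs_mul, abs_of_nonneg (add_nonneg (hb _) (hb _))]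
    have h3 : b (t+1) + b t ≤ 2 * b t + C * w t := by linarith [(abs_le.1 h1).2]
    calc _ ≤ (C * w t) * (2 * b t + C * w t) := by
          apply mul_le_mul h1 h3 (add_nonneg (hb _) (hb _)) (mul_nonneg hC (hw t))
      _ = _ := by ring
  have hcs := cauchySeq_of_dist_le_of_summable _ hc
    ((hs.mul_left (2*C)).add (hww.mul_left (C^2)))
  obtain ⟨l, hl⟩ := cauchySeq_tendsto_of_complete hcs
  have hl0 : 0 ≤ l := ge_of_tendsto' hl (fun t => sq_nonneg _)
  have hbl : Tendsto b atTop (𝓝 (Real.sqrt l)) := by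
    have := (Real.continuous_sqrt.tendsto l).comp hl
    refine this.congr (fun t => ?_)
    simp [Real.sqrt_sq (hb t)]
  rcases (Real.sqrt_nonneg l).eq_or_lt with h0 | h0
  · rwa [← h0] at hbl
  · exfalso
    apply hwd
    have hev := hbl.eventually (lt_mem_nhds (half_lt_self h0))
    have hs' := hs.mul_left (Real.sqrt l / 2)⁻¹
    apply summable_of_isBigO_nat hs'
    apply Asymptotics.IsBigO.of_bound 1
    filter_upwards [hev] with t ht
    rw [one_mul, Real.norm_of_nonneg (hw t), Real.norm_of_nonneg (by
      have := hw t; have := hb t; positivity)]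
    have h2 : 0 < Real.sqrt l / 2 := by positivity
    rw [le_inv_mul_iff₀ h2]
    nlinarith [hw t]

open Filter Topology Finset in
theorem prod_lemma (w : ℕ → ℝ) (hw : ∀ t, 0 ≤ w t) (hw1 : ∀ t, 1 ≤ t → w t < 1)
    (hwd : ¬ Summable w) :
    ∃ P : ℕ → ℝ, (∀ t, 0 < P t) ∧ (∀ t, 1 ≤ t → P (t+1) = (1 - w t) * P t) ∧
      Tendsto P atTop (𝓝 0) := by
  refine ⟨fun t => ∏ r ∈ Ico 1 t, (1 - w r), ?_, ?_, ?_⟩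
  · intro t
    apply prod_pos
    intro r hr
    linarith [hw1 r (mem_Ico.1 hr).1]
  · intro t ht
    simp only
    rw [prod_Ico_succ_top ht, mul_comm]
  · have h1 : Tendsto (fun t => ∑ r ∈ range t, w r) atTop atTop :=
      (not_summable_iff_tendsto_nat_atTop_of_nonneg hw).1 hwd
    have h2 : Tendsto (fun t => Real.exp (w 0 - ∑ r ∈ range t, w r)) atTop (𝓝 0) := by
      apply Real.tendsto_exp_atBot.comp
      exact tendsto_atBot_add_const_left _ _ (tendsto_neg_atTop_atBot.comp h1)
    refine squeeze_zero' (Eventually.of_forall fun t => ?_) ?_ h2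
    · apply prod_nonneg
      intro r hr
      linarith [hw1 r (mem_Ico.1 hr).1]
    · filter_upwards [eventually_ge_atTop 1] with t ht
      have : w 0 - ∑ r ∈ range t, w r = ∑ r ∈ Ico 1 t, (- w r) := by
        rw [range_eq_Ico, sum_eq_sum_Ico_succ_bot (by omega), sum_neg_distrib]; simp
      rw [this, Real.exp_sum]
      apply Finset.prod_le_prod
      · intro r hr
        linarith [hw1 r (mem_Ico.1 hr).1]
      · intro r _
        linarith [Real.add_one_le_exp (- w r)]

open Filter Topology in
theorem window_lemma (w P : ℕ → ℝ) (hP : ∀ t, 0 < P t)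
    (hrec : ∀ t, 1 ≤ t → P (t+1) = (1 - w t) * P t) (hP0 : Tendsto P atTop (𝓝 0))
    (N : ℕ) (hN : 1 ≤ N) (hw : ∀ t, N ≤ t → w t ≤ 1/2) (ε : ℝ) (hε : 0 < ε) (hε1 : ε < 1) :
    ∀ᶠ t in atTop, ∃ s, N ≤ s ∧ s ≤ t ∧ P t ≤ ε * P s ∧ ε / 2 * P s ≤ P t := by
  have h1 := hP0.eventually (gt_mem_nhds (mul_pos hε (hP N)))
  filter_upwards [h1, eventually_ge_atTop N] with t ht htN
  classical
  set s := Nat.findGreatest (fun s => P t ≤ ε * P s) t with hs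
  have hsN : N ≤ s := Nat.le_findGreatest htN ht.le
  have hst : s ≤ t := Nat.findGreatest_le t
  have hsp : P t ≤ ε * P s := Nat.findGreatest_spec (P := fun s => P t ≤ ε * P s) htN ht.le
  have hne : s ≠ t := by
    intro h
    rw [h] at hsp
    nlinarith [hP t]
  have hlt : ¬ (P t ≤ ε * P (s+1)) :=
    Nat.findGreatest_is_greatest (P := fun s => P t ≤ ε * P s) (Nat.lt_succ_self _) (by omega)
  refine ⟨s, hsN, hst, hsp, ?_⟩
  rw [hrec s (by omega)] at hlt
  have := hw s hsN
  have h3 : (1/2) * P s ≤ (1 - w s) * P s := by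
    apply mul_le_mul_of_nonneg_right _ (hP s).le
    linarith
  push Not at hlt
  nlinarith

open Filter Topology in
theorem det_lemma {E : Type*} [NormedAddCommGroup E]
    (Θ : Set E) (B : ℝ) (hB : ∀ x ∈ Θ, ∀ y ∈ Θ, ‖x - y‖ ≤ B)
    (R ρ L C M : ℝ) (hR : 0 < R) (hρ : 0 < ρ) (hL : 0 < L) (hC : 0 ≤ C) (hM : 0 ≤ M)
    (w : ℕ → ℝ) (hw : ∀ t, 0 ≤ w t) (hw1 : ∀ t, w t ≤ 1) (hw1' : ∀ t, 1 ≤ t → w t < 1)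
    (hww : Summable (fun t => w t ^ 2)) (hwd : ¬ Summable w)
    (θ : ℕ → E) (hθ : ∀ t, θ t ∈ Θ) (hΔ : ∀ t, ‖θ (t+1) - θ t‖ ≤ C * w t)
    (h H : ℕ → E → ℝ) (h0 : ∀ t, ∀ x ∈ Θ, 0 ≤ h t x) (hz : ∀ t, h t (θ t) = 0)
    (hq : ∀ t, ∀ x ∈ Θ, h t x ≤ L * ‖x - θ t‖ ^ 2)
    (hl : ∀ t, ∀ x ∈ Θ, ∀ y ∈ Θ, |h t x - h t y| ≤ M * ‖x - y‖)
    (H0 : ∀ x, H 0 x = 0) (HS : ∀ t x, H (t+1) x = (1 - w t) * H t x + w t * h t x)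
    (fbar : E → ℝ) (e : ℕ → E → ℝ) (δ : ℕ → ℝ)
    (hfbar : ∀ x y, |fbar x - fbar y| ≤ R * ‖x - y‖)
    (hδ : ∀ t, 0 ≤ δ t) (hδ0 : Tendsto δ atTop (𝓝 0))
    (hδs : Summable (fun t => w t * δ (t+1)))
    (heb : ∀ t, ∀ x ∈ Θ, |e t x| ≤ δ t) (hel : ∀ t x y, |e t x - e t y| ≤ δ t * ‖x - y‖)
    (hmin : ∀ t, 1 ≤ t → ∀ x ∈ Θ, H t (θ t) + (fbar (θ t) + e t (θ t)) + ρ / 2 * ‖x - θ t‖ ^ 2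
      ≤ H t x + (fbar x + e t x)) :
    (∃ l, Tendsto (fun t => fbar (θ t)) atTop (𝓝 l)) ∧
    ∀ ε, 0 < ε → ∀ᶠ t in atTop, ∀ y ∈ Θ, fbar (θ t) ≤ fbar y + 2 * L * ‖y - θ t‖ ^ 2 + ε := by
  have hB0 : 0 ≤ B := (norm_nonneg _).trans (hB _ (hθ 0) _ (hθ 0))
  have hHn : ∀ t, ∀ x ∈ Θ, 0 ≤ H t x := by
    intro t x hx
    induction t with
    | zero => rw [H0]
    | succ t ih =>
      rw [HS]
      have := hw1 t
      exact add_nonneg (mul_nonneg (by linarith) ih) (mul_nonneg (hw t) (h0 t x hx))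
  have hhB : ∀ t, ∀ x ∈ Θ, h t x ≤ L * B ^ 2 := by
    intro t x hx
    refine (hq t x hx).trans ?_
    have := hB x hx _ (hθ t)
    gcongr
  have hHB : ∀ t, ∀ x ∈ Θ, H t x ≤ L * B ^ 2 := by
    intro t x hx
    induction t with
    | zero => rw [H0]; positivity
    | succ t ih =>
      rw [HS]
      nlinarith [hw1 t, hw t, hhB t x hx,
        mul_le_mul_of_nonneg_left ih (sub_nonneg.2 (hw1 t)),
        mul_le_mul_of_nonneg_left (hhB t x hx) (hw t)]
  have hHl : ∀ t, ∀ x ∈ Θ, ∀ y ∈ Θ, |H t x - H t y| ≤ M * ‖x - y‖ := by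
    intro t x hx y hy
    induction t with
    | zero => rw [H0, H0]; simp; positivity
    | succ t ih =>
      rw [HS, HS]
      have e1 : (1 - w t) * H t x + w t * h t x - ((1 - w t) * H t y + w t * h t y)
        = (1 - w t) * (H t x - H t y) + w t * (h t x - h t y) := by ring
      rw [e1]
      refine (abs_add_le _ _).trans ?_
      rw [abs_mul, abs_mul, abs_of_nonneg (hw t), abs_of_nonneg (sub_nonneg.2 (hw1 t))]
      have := mul_le_mul_of_nonneg_left ih (sub_nonneg.2 (hw1 t))
      have := mul_le_mul_of_nonneg_left (hl t x hx y hy) (hw t)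
      linarith
  -- step 2
  have hstep : ∀ t, H (t+1) (θ (t+1)) + fbar (θ (t+1)) ≤
      H t (θ t) + fbar (θ t) - w t * H t (θ t) + C * (w t * δ (t+1)) := by
    intro t
    have h1 := hmin (t+1) (by omega) _ (hθ t)
    have h2 := HS t (θ t)
    rw [hz] at h2
    have h3 := (abs_le.1 (hel (t+1) (θ t) (θ (t+1)))).2
    have h4 : 0 ≤ ρ / 2 * ‖θ t - θ (t+1)‖ ^ 2 := by positivity
    have h5 := mul_le_mul_of_nonneg_left (hΔ t) (hδ (t+1))
    rw [norm_sub_rev] at h5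
    nlinarith
  have hwb : ∀ t, 0 ≤ w t * H t (θ t) := fun t => mul_nonneg (hw t) (hHn t _ (hθ t))
  obtain ⟨⟨l, hΨ⟩, hsum⟩ := rs_lemma (fun t => H t (θ t) + fbar (θ t))
    (fun t => C * (w t * δ (t+1))) (fun t => w t * H t (θ t)) hwb
    (fun t => mul_nonneg hC (mul_nonneg (hw t) (hδ _))) (hδs.mul_left C)
    (fbar (θ 0) - R * B) (by
      intro t
      have h1 := (abs_le.1 (hfbar (θ 0) (θ t))).2
      have h2 := mul_le_mul_of_nonneg_left (hB _ (hθ 0) _ (hθ t)) hR.le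
      linarith [hHn t _ (hθ t)]) hstep
  have hHt : Tendsto (fun t => H t (θ t)) atTop (𝓝 0) := by
    apply slow_lemma w _ (M * C + L * B ^ 2) (by positivity) hw hww hwd
      (fun t => hHn t _ (hθ t)) hsum
    intro t
    have h1 := hHl (t+1) _ (hθ (t+1)) _ (hθ t)
    have h2 := HS t (θ t)
    rw [hz] at h2
    have h3 := mul_le_mul_of_nonneg_left (hΔ t) hM
    have h4 := mul_le_mul_of_nonneg_left (hHB t _ (hθ t)) (hw t)
    have h5 := hwb t
    have h6 : 0 ≤ w t * (L * B ^ 2) := mul_nonneg (hw t) (by positivity)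
    rw [abs_le] at h1 ⊢
    constructor <;> nlinarith
  have hf : Tendsto (fun t => fbar (θ t)) atTop (𝓝 l) := by
    have := hΨ.sub hHt
    simpa using this
  refine ⟨⟨l, hf⟩, ?_⟩
  obtain ⟨P, hP, hPrec, hP0⟩ := prod_lemma w hw hw1' hwd
  have hPanti : ∀ r t, 1 ≤ r → r ≤ t → P t ≤ P r := by
    intro r t hr hrt
    induction t, hrt using Nat.le_induction with
    | base => exact le_rfl
    | succ t ht ih =>
      rw [hPrec t (by omega)]
      nlinarith [hw t, hP t]
  have hHlow : ∀ r t, 1 ≤ r → r ≤ t → ∀ x ∈ Θ, P t * H r x ≤ P r * H t x := by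
    intro r t hr hrt x hx
    induction t, hrt using Nat.le_induction with
    | base => exact le_rfl
    | succ t ht ih =>
      rw [hPrec t (by omega), HS]
      have h1 := mul_le_mul_of_nonneg_left ih (sub_nonneg.2 (hw1 t))
      have h2 : 0 ≤ P r * (w t * h t x) := mul_nonneg (hP r).le (mul_nonneg (hw t) (h0 t x hx))
      nlinarith
  have hHup : ∀ s t, 1 ≤ s → s ≤ t → ∀ x ∈ Θ, ∀ A, 0 ≤ A →
      (∀ r, s ≤ r → r < t → L * ‖x - θ r‖ ^ 2 ≤ A) →
      H t x ≤ P t / P s * (L * B ^ 2) + A := by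
    intro s t hs hst x hx A hA
    induction t, hst using Nat.le_induction with
    | base =>
      intro _
      rw [div_self (hP s).ne', one_mul]
      linarith [hHB s x hx]
    | succ t ht ih =>
      intro hr
      have h1 := ih (fun r h1 h2 => hr r h1 (by omega))
      have h2 := (hq t x hx).trans (hr t ht (by omega))
      rw [hPrec t (by omega), HS, mul_div_assoc]
      have h3 := mul_le_mul_of_nonneg_left h1 (sub_nonneg.2 (hw1 t))
      have h4 := mul_le_mul_of_nonneg_left h2 (hw t)
      nlinarith
  intro ε hε
  -- parameters
  set η : ℝ := min (1/2) (ε / (4 * (L * B ^ 2 + 1))) with hη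
  have hLB : 0 ≤ L * B ^ 2 := by positivity
  have hη0 : 0 < η := by rw [hη]; apply lt_min <;> positivity
  have hη1 : η < 1 := (min_le_left _ _).trans_lt (by norm_num)
  have hη2 : η * (L * B ^ 2) ≤ ε / 4 := by
    have h1 : η ≤ ε / (4 * (L * B ^ 2 + 1)) := min_le_right _ _
    have h2 : η * (4 * (L * B ^ 2 + 1)) ≤ ε := (le_div_iff₀ (by positivity)).1 h1
    nlinarith
  -- ν : bound on squared distances
  set ν : ℝ := ε * ρ / (16 * L) with hν
  have hν0 : 0 < ν := by positivity
  have hw0 : Tendsto w atTop (𝓝 0) := by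
    have := hww.tendsto_atTop_zero
    have h2 := (Real.continuous_sqrt.tendsto 0).comp this
    rw [Real.sqrt_zero] at h2
    exact h2.congr (fun t => by simp [Real.sqrt_sq (hw t)])
  have E1 := hw0.eventually (ge_mem_nhds (show (0:ℝ) < 1/2 by norm_num))
  have E2 := hδ0.eventually (ge_mem_nhds (show (0:ℝ) < min (ε / 4) (ν / 8) by positivity))
  have E3 := hf.eventually (Metric.ball_mem_nhds l (show 0 < ν / 8 by positivity))
  have E4 := hHt.eventually (ge_mem_nhds (show (0:ℝ) < ν / 4 * (η / 2) by positivity))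
  obtain ⟨N, hN⟩ := eventually_atTop.1 (E1.and (E2.and (E3.and E4)))
  have E5 := window_lemma w P hP hPrec hP0 (max N 1) (le_max_right _ _)
    (fun t ht => (hN t ((le_max_left _ _).trans ht)).1) η hη0 hη1
  filter_upwards [E5] with t ⟨s, hNs, hst, hPs1, hPs2⟩ y hy
  have hs1 : 1 ≤ s := (le_max_right _ _).trans hNs
  have hsN : N ≤ s := (le_max_left _ _).trans hNs
  obtain ⟨-, ht2, ht3, ht4⟩ := hN t (by omega)
  have hdist : ∀ r, s ≤ r → r < t → ρ / 2 * ‖θ t - θ r‖ ^ 2 ≤ ν := by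
    intro r hsr hrt
    obtain ⟨-, hr2, hr3, -⟩ := hN r (by omega)
    have h1 := hmin r (by omega) _ (hθ t)
    have h2 := hHlow r t (by omega) hrt.le _ (hθ t)
    have h3 : H r (θ t) ≤ ν / 4 := by
      have h4 : P r ≤ P s := hPanti s r hs1 hsr
      have h5 : η / 2 * P r ≤ P t := (mul_le_mul_of_nonneg_left h4 (by positivity)).trans hPs2
      have h6 : P r * H t (θ t) ≤ P r * (ν / 4 * (η / 2)) :=
        mul_le_mul_of_nonneg_left ht4 (hP r).le
      have h7 : P r * (ν / 4 * (η / 2)) ≤ P t * (ν / 4) := by nlinarith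
      exact le_of_mul_le_mul_left (h2.trans (h6.trans h7)) (hP t)
    have h4 := hHn r _ (hθ r)
    rw [Real.dist_eq, abs_lt] at ht3 hr3
    have h5 := abs_le.1 (heb r _ (hθ t))
    have h6 := abs_le.1 (heb r _ (hθ r))
    have h7 := hr2.trans (min_le_right _ _)
    linarith [ht3.1, ht3.2, hr3.1, hr3.2]
  have hdist2 : ∀ r, s ≤ r → r < t → L * ‖y - θ r‖ ^ 2 ≤ 2 * L * ‖y - θ t‖ ^ 2 + ε / 4 := by
    intro r hsr hrt
    have h1 := hdist r hsr hrt
    have h2 : ‖y - θ r‖ ≤ ‖y - θ t‖ + ‖θ t - θ r‖ := norm_sub_le_norm_sub_add_norm_sub _ _ _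
    have h3 : ‖y - θ r‖ ^ 2 ≤ 2 * ‖y - θ t‖ ^ 2 + 2 * ‖θ t - θ r‖ ^ 2 := by
      have := pow_le_pow_left₀ (norm_nonneg _) h2 2
      nlinarith [sq_nonneg (‖y - θ t‖ - ‖θ t - θ r‖)]
    have h4 : L * ‖θ t - θ r‖ ^ 2 ≤ ε / 8 := by
      have : ρ * (L * ‖θ t - θ r‖ ^ 2) ≤ ρ * (ε / 8) := by
        have h5 := mul_le_mul_of_nonneg_left h1 hL.le
        have h6 : L * ν = ε * ρ / 16 := by rw [hν]; field_simp
        nlinarith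
      exact le_of_mul_le_mul_left this hρ
    nlinarith
  have h1 := hHup s t hs1 hst y hy (2 * L * ‖y - θ t‖ ^ 2 + ε / 4) (by positivity) hdist2
  have h2 : P t / P s * (L * B ^ 2) ≤ ε / 4 := by
    have : P t / P s ≤ η := (div_le_iff₀ (hP s)).2 hPs1
    exact (mul_le_mul_of_nonneg_right this hLB).trans hη2
  have h3 := hmin t (by omega) y hy
  have h4 := hHn t _ (hθ t)
  have h5 := abs_le.1 (heb t _ (hθ t))
  have h6 := abs_le.1 (heb t _ hy)
  have h7 := ht2.trans (min_le_left _ _)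
  have h8 : 0 ≤ ρ / 2 * ‖y - θ t‖ ^ 2 := by positivity
  linarith

open Filter Topology MeasureTheory ProbabilityTheory in
theorem prob_lemma {Ω : Type*} {m0 : MeasurableSpace Ω} (μ : Measure Ω) [IsProbabilityMeasure μ]
    (F : Filtration ℕ m0) (w : ℕ → ℝ) (hw : ∀ t, 0 ≤ w t) (hw1 : ∀ t, w t ≤ 1)
    (hwone : w 1 = 1)
    (hwm : ∀ t : ℕ, t * w t ≤ (t+1) * w (t+1)) (hwl : ∀ t : ℕ, 1 ≤ (t+1) * w (t+1))
    (hws : Summable (fun t => w t * √(w t)))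
    (ξ : ℕ → Ω → ℝ) (hξ1 : ∀ t ω, |ξ t ω| ≤ 1) (hξm : ∀ t, Measurable[F (t+1)] (ξ t))
    (hξ0 : ∀ t, ∫ ω, ξ t ω ∂μ = 0)
    (hξi : ∀ t, Indep (MeasurableSpace.comap (ξ t) inferInstance) (F t) μ)
    (D : ℕ → Ω → ℝ) (D0 : ∀ ω, D 0 ω = 0)
    (DS : ∀ t ω, D (t+1) ω = (1 - w (t+1)) * D t ω + w (t+1) * ξ t ω) :
    ∀ᵐ ω ∂μ, Summable (fun t => w t * |D t ω|) := by
  have hDm : ∀ t, Measurable[F t] (D t) := by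
    intro t
    induction t with
    | zero =>
      have : D 0 = fun _ => 0 := funext D0
      rw [this]; exact measurable_const
    | succ t ih =>
      have : D (t+1) = fun ω => (1 - w (t+1)) * D t ω + w (t+1) * ξ t ω := funext (DS t)
      rw [this]
      have h1 : Measurable[F (t+1)] (D t) := ih.mono (F.mono (Nat.le_succ t)) le_rfl
      exact (h1.const_mul _).add ((hξm t).const_mul _)
  have hDm' : ∀ t, Measurable (D t) := fun t => (hDm t).mono (F.le t) le_rfl
  have hξm' : ∀ t, Measurable (ξ t) := fun t => (hξm t).mono (F.le _) le_rfl
  have hDb : ∀ t ω, |D t ω| ≤ 1 := by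
    intro t ω
    induction t with
    | zero => rw [D0]; simp
    | succ t ih =>
      rw [DS]
      refine (abs_add_le _ _).trans ?_
      rw [abs_mul, abs_mul, abs_of_nonneg (hw _), abs_of_nonneg (sub_nonneg.2 (hw1 _))]
      have := mul_le_mul_of_nonneg_left ih (sub_nonneg.2 (hw1 (t+1)))
      have := mul_le_mul_of_nonneg_left (hξ1 t ω) (hw (t+1))
      linarith
  have hint : ∀ X : Ω → ℝ, Measurable X → (∀ ω, |X ω| ≤ 1) → Integrable X μ := by
    intro X hX hb
    exact Integrable.of_bound hX.aestronglyMeasurable 1 (ae_of_all _ hb)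
  have hmulb : ∀ a b : ℝ, |a| ≤ 1 → |b| ≤ 1 → |a * b| ≤ 1 := by
    intro a b ha hb
    rw [abs_mul]
    exact mul_le_one₀ ha (abs_nonneg _) hb
  have iD2 : ∀ t, Integrable (fun ω => D t ω * D t ω) μ := fun t =>
    hint _ ((hDm' t).mul (hDm' t)) (fun ω => hmulb _ _ (hDb t ω) (hDb t ω))
  have iDξ : ∀ t, Integrable (fun ω => D t ω * ξ t ω) μ := fun t =>
    hint _ ((hDm' t).mul (hξm' t)) (fun ω => hmulb _ _ (hDb t ω) (hξ1 t ω))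
  have iξ2 : ∀ t, Integrable (fun ω => ξ t ω * ξ t ω) μ := fun t =>
    hint _ ((hξm' t).mul (hξm' t)) (fun ω => hmulb _ _ (hξ1 t ω) (hξ1 t ω))
  have hcross : ∀ t, ∫ ω, D t ω * ξ t ω ∂μ = 0 := by
    intro t
    have hI : IndepFun (D t) (ξ t) μ := by
      rw [IndepFun_iff_Indep]
      exact (indep_of_indep_of_le_right (hξi t) (hDm t).comap_le).symm
    have := hI.integral_mul_eq_mul_integral (hDm' t).aestronglyMeasurable
      (hξm' t).aestronglyMeasurable
    rw [hξ0, mul_zero] at this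
    exact this
  have hv : ∀ t, ∫ ω, D t ω * D t ω ∂μ ≤ w t := by
    intro t
    induction t with
    | zero => simp [D0, hw]
    | succ t ih =>
      set a := w (t+1) with ha
      have e1 : ∀ ω, D (t+1) ω * D (t+1) ω = (1-a)^2 * (D t ω * D t ω) +
          (2 * (1-a) * a * (D t ω * ξ t ω) + a^2 * (ξ t ω * ξ t ω)) := by
        intro ω; rw [DS]; ring
      have e2 : ∫ ω, D (t+1) ω * D (t+1) ω ∂μ = (1-a)^2 * (∫ ω, D t ω * D t ω ∂μ) +
          (2 * (1-a) * a * (∫ ω, D t ω * ξ t ω ∂μ) + a^2 * ∫ ω, ξ t ω * ξ t ω ∂μ) := by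
        simp_rw [e1]
        have i2 : Integrable (fun ω => 2 * (1-a) * a * (D t ω * ξ t ω) +
            a^2 * (ξ t ω * ξ t ω)) μ := ((iDξ t).const_mul _).add ((iξ2 t).const_mul _)
        rw [integral_add ((iD2 t).const_mul _) i2,
          integral_add ((iDξ t).const_mul _) ((iξ2 t).const_mul _),
          integral_const_mul, integral_const_mul, integral_const_mul]
      have e3 : ∫ ω, ξ t ω * ξ t ω ∂μ ≤ 1 := by
        have := integral_mono (iξ2 t) (integrable_const (1:ℝ)) (fun ω =>
          (abs_le.1 (hmulb _ _ (hξ1 t ω) (hξ1 t ω))).2)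
        simpa using this
      rw [e2, hcross, mul_zero, zero_add]
      have h1 := mul_le_mul_of_nonneg_left ih (sq_nonneg (1-a))
      have h2 := mul_le_mul_of_nonneg_left e3 (sq_nonneg a)
      have ha0 : 0 ≤ a := hw _
      have ha1 : a ≤ 1 := hw1 _
      suffices (1-a)^2 * w t + a^2 ≤ a by linarith
      rcases Nat.eq_zero_or_pos t with h0 | h0
      · subst h0
        have : a = 1 := hwone
        rw [this]; norm_num
      · have ht : (1:ℝ) ≤ t := by exact_mod_cast h0
        have h3 := hwm t
        have h4 := hwl t
        rw [← ha] at h3 h4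
        have h5 : (1-a)^2 * (t * w t) ≤ (1-a)^2 * ((t+1) * a) :=
          mul_le_mul_of_nonneg_left h3 (sq_nonneg _)
        have h6 : t * ((1-a)^2 * w t + a^2) ≤ t * a := by
          have h7 : 0 ≤ a * (1-a) * ((t+1) * a - 1) :=
            mul_nonneg (mul_nonneg ha0 (by linarith)) (by linarith)
          nlinarith
        exact le_of_mul_le_mul_left h6 (by linarith)
  have habs : ∀ t, ∫ ω, w t * |D t ω| ∂μ ≤ w t * √(w t) := by
    intro t
    rcases (hw t).eq_or_lt with h0 | h0
    · simp [← h0]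
    · have hs : 0 < √(w t) := Real.sqrt_pos.2 h0
      have hsq : √(w t) * √(w t) = w t := Real.mul_self_sqrt h0.le
      rw [integral_const_mul]
      apply mul_le_mul_of_nonneg_left _ h0.le
      have h1 : √(w t) * ∫ ω, |D t ω| ∂μ ≤ √(w t) * √(w t) := by
        rw [← integral_const_mul]
        have := integral_mono (μ := μ) (f := fun ω => √(w t) * |D t ω|)
          (g := fun ω => (1/2) * w t + (1/2) * (D t ω * D t ω))
          ((hint _ (hDm' t) (hDb t)).abs.const_mul _)
          ((integrable_const _).add ((iD2 t).const_mul _)) (by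
            intro ω
            simp only
            nlinarith [sq_nonneg (√(w t) - |D t ω|), abs_mul_abs_self (D t ω)])
        rw [integral_add (integrable_const _) ((iD2 t).const_mul _),
          integral_const_mul (1/2 : ℝ) (fun ω => D t ω * D t ω), integral_const, probReal_univ,
          one_smul] at this
        linarith [hv t]
      exact le_of_mul_le_mul_left h1 hs
  have hmeas : ∀ t, Measurable (fun ω => w t * |D t ω|) := fun t =>
    ((hDm' t).abs).const_mul _
  have hnn : ∀ t ω, 0 ≤ w t * |D t ω| := fun t ω => mul_nonneg (hw t) (abs_nonneg _)
  have hfin : ∫⁻ ω, ∑' t, ENNReal.ofReal (w t * |D t ω|) ∂μ ≠ ⊤ := by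
    rw [lintegral_tsum (fun t => (hmeas t).ennreal_ofReal.aemeasurable)]
    have h1 : ∀ t, ∫⁻ ω, ENNReal.ofReal (w t * |D t ω|) ∂μ ≤ ENNReal.ofReal (w t * √(w t)) := by
      intro t
      rw [← ofReal_integral_eq_lintegral_ofReal
        ((hint _ (hDm' t) (hDb t)).abs.const_mul _) (ae_of_all _ (hnn t))]
      exact ENNReal.ofReal_le_ofReal (habs t)
    exact ne_top_of_le_ne_top hws.tsum_ofReal_ne_top (ENNReal.tsum_le_tsum h1)
  have hae := ae_lt_top (Measurable.tsum (fun t => (hmeas t).ennreal_ofReal)) hfin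
  filter_upwards [hae] with ω hω
  have := ENNReal.summable_toReal hω.ne
  refine this.congr (fun t => ?_)
  rw [ENNReal.toReal_ofReal (hnn t ω)]

open Set in
theorem sc_min {E : Type*} [NormedAddCommGroup E] [InnerProductSpace ℝ E] (Θ : Set E)
    (hΘ : Convex ℝ Θ) (ρ : ℝ) (g : E → ℝ)
    (hg : ConvexOn ℝ univ (fun x => g x - ρ / 2 * ‖x‖ ^ 2)) (z : E) (hz : z ∈ Θ)
    (hmin : ∀ x ∈ Θ, g z ≤ g x) (x : E) (hx : x ∈ Θ) :
    g z + ρ / 2 * ‖x - z‖ ^ 2 ≤ g x := by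
  have hsc : StrongConvexOn univ ρ g := strongConvexOn_iff_convex.2 hg
  have key : ∀ c : ℝ, c ∈ Ioo (0:ℝ) 1 → g z + ρ / 2 * ‖x - z‖ ^ 2 * (1 - c) ≤ g x := by
    rintro c ⟨h0, h1⟩
    have h2 := hsc.2 (mem_univ x) (mem_univ z) h0.le (sub_nonneg.2 h1.le) (by ring)
    have h3 := hmin _ (hΘ hx hz h0.le (sub_nonneg.2 h1.le) (by ring))
    simp only [smul_eq_mul] at h2
    have h4 : c * (g z + ρ / 2 * ‖x - z‖ ^ 2 * (1 - c)) ≤ c * g x := by nlinarith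
    exact le_of_mul_le_mul_left h4 h0
  have hlim : Filter.Tendsto (fun c : ℝ => g z + ρ / 2 * ‖x - z‖ ^ 2 * (1 - c))
      (nhdsWithin 0 (Ioi 0)) (nhds (g z + ρ / 2 * ‖x - z‖ ^ 2 * (1 - 0))) := by
    apply Filter.Tendsto.mono_left _ nhdsWithin_le_nhds
    exact (by fun_prop : Continuous (fun c : ℝ => g z + ρ / 2 * ‖x - z‖ ^ 2 * (1 - c))).tendsto 0
  rw [sub_zero, mul_one] at hlim
  refine le_of_tendsto hlim ?_
  filter_upwards [Ioo_mem_nhdsGT (show (0:ℝ) < 1 by norm_num)] with c hc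
  exact key c hc

theorem grad_bounds {E : Type*} [NormedAddCommGroup E] [InnerProductSpace ℝ E] [CompleteSpace E]
    (Θ : Set E) (hΘ : Convex ℝ Θ) (B : ℝ) (hB : ∀ x ∈ Θ, ∀ y ∈ Θ, ‖x - y‖ ≤ B)
    (L : ℝ) (hL : 0 < L) (h : E → ℝ) (hd : Differentiable ℝ h)
    (hlip : ∀ x y, ‖gradient h x - gradient h y‖ ≤ L * ‖x - y‖) (p : E) (hp : p ∈ Θ)
    (hgp : gradient h p = 0) (hhp : h p = 0) :
    (∀ x ∈ Θ, h x ≤ L * ‖x - p‖ ^ 2) ∧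
    (∀ x ∈ Θ, ∀ y ∈ Θ, |h x - h y| ≤ L * B * ‖x - y‖) := by
  have hn : ∀ z, ‖fderiv ℝ h z‖ ≤ L * ‖z - p‖ := by
    intro z
    have h1 := hlip z p
    rw [hgp, sub_zero] at h1
    rwa [gradient, LinearIsometryEquiv.norm_map] at h1
  constructor
  · intro x hx
    have h1 := (convex_closedBall p ‖x - p‖).norm_image_sub_le_of_norm_fderiv_le
      (f := h) (𝕜 := ℝ) (C := L * ‖x - p‖) (fun z _ => hd z) (by
        intro z hz
        refine (hn z).trans ?_
        rw [mem_closedBall_iff_norm] at hz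
        gcongr) (x := p) (y := x) (by simp) (by simp [dist_eq_norm])
    rw [hhp, sub_zero] at h1
    have := (Real.le_norm_self _).trans h1
    nlinarith
  · intro x hx y hy
    have h1 := hΘ.norm_image_sub_le_of_norm_fderiv_le
      (f := h) (𝕜 := ℝ) (C := L * B) (fun z _ => hd z) (by
        intro z hz
        refine (hn z).trans ?_
        have := hB z hz p hp
        gcongr) hy hx
    exact h1

open Filter Topology in
theorem w_facts (u : ℝ) (hu : 3 / 4 < u) (hu1 : u < 1)
    (w : ℕ → ℝ) (hw : ∀ t, w t = (t : ℝ) ^ (-u)) :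
    (∀ t, 0 ≤ w t) ∧ (∀ t, w t ≤ 1) ∧ w 0 = 0 ∧ w 1 = 1 ∧ (∀ t, 2 ≤ t → w t < 1) ∧
    (∀ t, 1 ≤ t → w (t+1) ≤ w t) ∧
    (∀ t : ℕ, t * w t ≤ (t+1) * w (t+1)) ∧ (∀ t : ℕ, 1 ≤ (t+1) * w (t+1)) ∧
    Summable (fun t => w t * √(w t)) ∧ Summable (fun t => w t ^ 2) ∧ ¬ Summable w := by
  have h0 : w 0 = 0 := by rw [hw]; simp; rw [Real.zero_rpow (by linarith)]
  have h1 : w 1 = 1 := by rw [hw]; simp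
  have hnn : ∀ t, 0 ≤ w t := fun t => by rw [hw]; positivity
  have hmul : ∀ t : ℕ, (t:ℝ) * w t = (t:ℝ) ^ (1 - u) := by
    intro t
    rcases Nat.eq_zero_or_pos t with h | h
    · subst h; simp; rw [Real.zero_rpow (by linarith)]
    · have ht : (0:ℝ) < t := by exact_mod_cast h
      rw [hw, sub_eq_add_neg, Real.rpow_add ht, Real.rpow_one]
  have hle1 : ∀ t : ℕ, 1 ≤ t → w t ≤ 1 := by
    intro t ht
    rw [hw]
    exact Real.rpow_le_one_of_one_le_of_nonpos (by exact_mod_cast ht) (by linarith)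
  have hpow : ∀ r : ℝ, ∀ t : ℕ, w t ^ r = (t:ℝ) ^ (-u * r) := by
    intro r t
    rw [hw, ← Real.rpow_mul (Nat.cast_nonneg t)]
  refine ⟨hnn, ?_, h0, h1, ?_, ?_, ?_, ?_, ?_, ?_, ?_⟩
  · intro t
    rcases Nat.eq_zero_or_pos t with h | h
    · subst h; rw [h0]; norm_num
    · exact hle1 t h
  · intro t ht
    rw [hw]
    exact Real.rpow_lt_one_of_one_lt_of_neg (by exact_mod_cast ht) (by linarith)
  · intro t ht
    rw [hw, hw]
    exact Real.rpow_le_rpow_of_nonpos (by exact_mod_cast ht) (by push_cast; linarith) (by linarith)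
  · intro t
    have := hmul (t+1)
    push_cast at this
    rw [hmul, this]
    exact Real.rpow_le_rpow (Nat.cast_nonneg t) (by linarith) (by linarith)
  · intro t
    have := hmul (t+1)
    push_cast at this
    rw [this]
    exact Real.one_le_rpow (by linarith [Nat.cast_nonneg (α := ℝ) t]) (by linarith)
  · have : Summable (fun t : ℕ => (t:ℝ) ^ (-u * (3/2))) := Real.summable_nat_rpow.2 (by linarith)
    refine this.congr (fun t => ?_)
    rw [← hpow, Real.sqrt_eq_rpow]
    rcases (hnn t).eq_or_lt with h | h
    · rw [← h]; simp
    · rw [← Real.rpow_one_add' (hnn t) (by norm_num)]; norm_num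
  · have : Summable (fun t : ℕ => (t:ℝ) ^ (-u * 2)) := Real.summable_nat_rpow.2 (by linarith)
    refine this.congr (fun t => ?_)
    rw [← hpow]; norm_num
  · have : w = fun t : ℕ => (t:ℝ) ^ (-u) := funext hw
    rw [this, Real.summable_nat_rpow]
    linarith

/-- Weighted averages `d_{t+1} = (1 - w_{t+1}) d_t + w_{t+1} ξ_t`, `d_0 = 0`. -/
noncomputable def dseq (w ξ : ℕ → ℝ) : ℕ → ℝ
  | 0 => 0
  | t + 1 => (1 - w (t+1)) * dseq w ξ t + w (t+1) * ξ t

open Filter Topology in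
theorem path_lemma {K n : ℕ} (hn : 1 ≤ n)
    (Θ : Set (EuclideanSpace ℝ (Fin K)))
    (hΘcomp : IsCompact Θ) (hΘconv : Convex ℝ Θ)
    (R ρ L : ℝ) (hR : 0 < R) (hρ : 0 < ρ) (hL : 0 < L)
    (f : Fin n → EuclideanSpace ℝ (Fin K) → ℝ)
    (hflip : ∀ i, ∀ x y : EuclideanSpace ℝ (Fin K), |f i x - f i y| ≤ R * ‖x - y‖)
    (hfbdd : ∃ M, ∀ i, ∀ x ∈ Θ, |f i x| ≤ M)
    (fbar : EuclideanSpace ℝ (Fin K) → ℝ)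
    (hfbar : ∀ x, fbar x = (1 / n : ℝ) * ∑ i, f i x)
    (w : ℕ → ℝ) (hw0 : ∀ t, 0 ≤ w t) (hw1 : ∀ t, w t ≤ 1) (hwz : w 0 = 0) (hwone : w 1 = 1)
    (hwlt : ∀ t, 2 ≤ t → w t < 1) (hwmono : ∀ t, 1 ≤ t → w (t+1) ≤ w t)
    (hww : Summable (fun t => w t ^ 2)) (hwd : ¬ Summable w)
    (idx : ℕ → Fin n)
    (g gbar : ℕ → EuclideanSpace ℝ (Fin K) → ℝ)
    (θ : ℕ → EuclideanSpace ℝ (Fin K))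
    (hθΘ : ∀ t, θ t ∈ Θ)
    (hgbar1 : gbar 1 = g 1)
    (hgbarrec : ∀ t, 2 ≤ t → ∀ x,
      gbar t x = (1 - w t) * gbar (t - 1) x + w t * g t x)
    (hsurr : ∀ t, 1 ≤ t → IsSurrogate Θ ρ L (f (idx t)) (g t) (θ (t - 1)))
    (hmin : ∀ t, 1 ≤ t → ∀ x ∈ Θ, gbar t (θ t) ≤ gbar t x)
    (hD : ∀ i, Summable (fun t => w t *
      |dseq w (fun s => (if idx (s+1) = i then (1:ℝ) else 0) - 1 / n) t|)) :
      (∃ l, Tendsto (fun t => fbar (θ t)) atTop (𝓝 l)) ∧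
      ∀ θlim : EuclideanSpace ℝ (Fin K),
        MapClusterPt θlim atTop (fun t => θ t) →
        ∀ x ∈ Θ, ∀ d, HasDirDeriv fbar θlim (x - θlim) d → 0 ≤ d := by
  obtain ⟨M0, hM0⟩ := hfbdd
  set M := max M0 0 with hM
  have hMnn : 0 ≤ M := le_max_right _ _
  have hfM : ∀ i, ∀ x ∈ Θ, |f i x| ≤ M := fun i x hx => (hM0 i x hx).trans (le_max_left _ _)
  have hnpos : (0:ℝ) < n := by exact_mod_cast hn
  obtain ⟨B, hB⟩ : ∃ B, ∀ x ∈ Θ, ∀ y ∈ Θ, ‖x - y‖ ≤ B := by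
    obtain ⟨B, hB⟩ := Metric.isBounded_iff.1 hΘcomp.isBounded
    exact ⟨B, fun x hx y hy => by rw [← dist_eq_norm]; exact hB hx hy⟩
  have hB0 : 0 ≤ B := (norm_nonneg _).trans (hB _ (hθΘ 0) _ (hθΘ 0))
  set D : ℕ → Fin n → ℝ := fun t i =>
    dseq w (fun s => (if idx (s+1) = i then (1:ℝ) else 0) - 1 / n) t with hDdef
  have D0 : ∀ i, D 0 i = 0 := fun i => rfl
  have DS : ∀ t i, D (t+1) i = (1 - w (t+1)) * D t i +
    w (t+1) * ((if idx (t+1) = i then (1:ℝ) else 0) - 1 / n) := fun t i => rfl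
  set h : ℕ → EuclideanSpace ℝ (Fin K) → ℝ := fun t x => g (t+1) x - f (idx (t+1)) x with hh
  set H : ℕ → EuclideanSpace ℝ (Fin K) → ℝ := fun t x => dseq w (fun s => h s x) t with hH
  have H0 : ∀ x, H 0 x = 0 := fun x => rfl
  have HS : ∀ t x, H (t+1) x = (1 - w (t+1)) * H t x + w (t+1) * h t x := fun t x => rfl
  set e : ℕ → EuclideanSpace ℝ (Fin K) → ℝ := fun t x => ∑ i, D t i * f i x with he
  have hsurr' : ∀ t, IsSurrogate Θ ρ L (f (idx (t+1))) (g (t+1)) (θ t) := fun t =>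
    hsurr (t+1) (by omega)
  have hfb : ∀ t x, fbar x + e (t+1) x = (1 - w (t+1)) * (fbar x + e t x) +
      w (t+1) * f (idx (t+1)) x := by
    intro t x
    have h1 : e (t+1) x = (1 - w (t+1)) * e t x + w (t+1) * (f (idx (t+1)) x - fbar x) := by
      simp only [he, DS, hfbar]
      have : f (idx (t+1)) x = ∑ i, (if idx (t+1) = i then (1:ℝ) else 0) * f i x := by simp
      rw [this, Finset.mul_sum, Finset.mul_sum, ← Finset.sum_sub_distrib, Finset.mul_sum,
        ← Finset.sum_add_distrib]
      exact Finset.sum_congr rfl fun i _ => by ring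
    rw [h1]; ring
  have hG : ∀ t x, H (t+1) x + (fbar x + e (t+1) x) =
      (1 - w (t+1)) * (H t x + (fbar x + e t x)) + w (t+1) * g (t+1) x := by
    intro t x
    rw [hfb, HS, hh]; ring
  have hGb : ∀ t, 1 ≤ t → ∀ x, gbar t x = H t x + (fbar x + e t x) := by
    intro t ht
    induction t, ht using Nat.le_induction with
    | base =>
      intro x
      have := hG 0 x
      rw [zero_add, hwone] at this
      rw [this, hgbar1]; ring
    | succ t ht ih =>
      intro x
      rw [hG, ← ih x, hgbarrec (t+1) (by omega)]
      simp
  have hconv : ∀ t, 1 ≤ t → ConvexOn ℝ Set.univ (fun x => gbar t x - ρ / 2 * ‖x‖ ^ 2) := by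
    intro t ht
    induction t, ht using Nat.le_induction with
    | base => rw [hgbar1]; exact (hsurr 1 le_rfl).1
    | succ t ht ih =>
      have h1 := (ih.smul (sub_nonneg.2 (hw1 (t+1)))).add ((hsurr (t+1) (by omega)).1.smul (hw0 (t+1)))
      have e1 : (fun x => gbar (t+1) x - ρ / 2 * ‖x‖ ^ 2) =
          ((fun x => (1 - w (t + 1)) • (gbar t x - ρ / 2 * ‖x‖ ^ 2)) +
            fun x => w (t + 1) • (g (t + 1) x - ρ / 2 * ‖x‖ ^ 2)) := by
        funext x
        rw [hgbarrec (t+1) (by omega)]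
        simp
        ring
      rw [e1]
      exact h1
  have hmin' : ∀ t, 1 ≤ t → ∀ x ∈ Θ, H t (θ t) + (fbar (θ t) + e t (θ t)) +
      ρ / 2 * ‖x - θ t‖ ^ 2 ≤ H t x + (fbar x + e t x) := by
    intro t ht x hx
    rw [← hGb t ht, ← hGb t ht]
    exact sc_min Θ hΘconv ρ _ (hconv t ht) _ (hθΘ t) (hmin t ht) x hx
  have hgrad := fun t => grad_bounds Θ hΘconv B hB L hL _ (hsurr' t).2.2.2.1
    (hsurr' t).2.2.2.2.1 (θ t) (hθΘ t) (hsurr' t).2.2.2.2.2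
    (by rw [(hsurr' t).2.2.1, sub_self])
  have hz : ∀ t, h t (θ t) = 0 := fun t => by
    simp only [hh]; rw [(hsurr' t).2.2.1, sub_self]
  have h0 : ∀ t, ∀ x ∈ Θ, 0 ≤ h t x := fun t x hx => sub_nonneg.2 ((hsurr' t).2.1 x hx)
  have hΔ : ∀ t, ‖θ (t+1) - θ t‖ ≤ 2 * R / ρ * w (t+1) := by
    intro t
    have h1 := hmin' (t+1) (by omega) _ (hθΘ t)
    rw [hG, hG] at h1
    have h2 : (1 - w (t+1)) * (H t (θ t) + (fbar (θ t) + e t (θ t))) ≤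
        (1 - w (t+1)) * (H t (θ (t+1)) + (fbar (θ (t+1)) + e t (θ (t+1)))) := by
      rcases Nat.eq_zero_or_pos t with ht | ht
      · subst ht; simp [hwone]
      · apply mul_le_mul_of_nonneg_left _ (sub_nonneg.2 (hw1 _))
        rw [← hGb t ht, ← hGb t ht]
        exact hmin t ht _ (hθΘ _)
    have h3 : g (t+1) (θ t) - g (t+1) (θ (t+1)) ≤ R * ‖θ t - θ (t+1)‖ := by
      have h4 := hz t
      have h5 := h0 t _ (hθΘ (t+1))
      simp only [hh] at h4 h5
      have h6 := (abs_le.1 (hflip (idx (t+1)) (θ t) (θ (t+1)))).2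
      linarith
    have h4 := mul_le_mul_of_nonneg_left h3 (hw0 (t+1))
    rw [norm_sub_rev]
    have h5 : ρ / 2 * ‖θ t - θ (t+1)‖ ^ 2 ≤ w (t+1) * (R * ‖θ t - θ (t+1)‖) := by linarith
    rcases (norm_nonneg (θ t - θ (t+1))).eq_or_lt with h6 | h6
    · rw [← h6]; have := hw0 (t+1); positivity
    · have h7 : ρ / 2 * ‖θ t - θ (t+1)‖ ≤ w (t+1) * R := by
        apply le_of_mul_le_mul_right _ h6
        linarith
      rw [div_mul_eq_mul_div, le_div_iff₀ hρ]
      linarith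
  have hww' : Summable (fun t => w (t+1) ^ 2) := (summable_nat_add_iff 1).2 hww
  have hwd' : ¬ Summable (fun t => w (t+1)) := fun hc => hwd ((summable_nat_add_iff 1).1 hc)
  have hDa : ∀ i, Tendsto (fun t => |D t i|) atTop (𝓝 0) := by
    intro i
    have hDb : ∀ t, |D t i| ≤ 1 ∧ |((if idx (t+1) = i then (1:ℝ) else 0) - 1 / n)| ≤ 1 := by
      have hx : ∀ t, |((if idx (t+1) = i then (1:ℝ) else 0) - 1 / n)| ≤ 1 := by
        intro t
        have h1 : (1:ℝ) / n ≤ 1 := by rw [div_le_one hnpos]; exact_mod_cast hn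
        have h2 : (0:ℝ) ≤ 1 / n := by positivity
        rw [abs_le]
        split_ifs <;> constructor <;> linarith
      intro t
      refine ⟨?_, hx t⟩
      induction t with
      | zero => rw [D0]; simp
      | succ t ih =>
        rw [DS]
        refine (abs_add_le _ _).trans ?_
        rw [abs_mul, abs_mul, abs_of_nonneg (hw0 _), abs_of_nonneg (sub_nonneg.2 (hw1 _))]
        have := mul_le_mul_of_nonneg_left ih (sub_nonneg.2 (hw1 (t+1)))
        have := mul_le_mul_of_nonneg_left (hx t) (hw0 (t+1))
        linarith
    apply slow_lemma (fun t => w (t+1)) _ 2 (by norm_num) (fun t => hw0 _) hww' hwd'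
      (fun t => abs_nonneg _)
    · refine Summable.of_nonneg_of_le (fun t => mul_nonneg (hw0 _) (abs_nonneg _)) ?_ (hD i)
      intro t
      rcases Nat.eq_zero_or_pos t with ht | ht
      · subst ht; rw [D0]; simp; exact mul_nonneg (hw0 _) (abs_nonneg _)
      · exact mul_le_mul_of_nonneg_right (hwmono t ht) (abs_nonneg _)
    · intro t
      refine (abs_abs_sub_abs_le_abs_sub _ _).trans ?_
      have e1 : D (t+1) i - D t i =
        w (t+1) * (((if idx (t+1) = i then (1:ℝ) else 0) - 1 / n) - D t i) := by rw [DS]; ring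
      rw [e1, abs_mul, abs_of_nonneg (hw0 _), mul_comm]
      apply mul_le_mul_of_nonneg_right _ (hw0 _)
      refine (abs_sub _ _).trans ?_
      linarith [(hDb t).1, (hDb t).2]
  have hfl : ∀ x y, |fbar x - fbar y| ≤ R * ‖x - y‖ := by
    intro x y
    rw [hfbar, hfbar, ← mul_sub, ← Finset.sum_sub_distrib, abs_mul, abs_of_nonneg (by positivity)]
    have h1 : |∑ i, (f i x - f i y)| ≤ ∑ i : Fin n, R * ‖x - y‖ :=
      (Finset.abs_sum_le_sum_abs _ _).trans (Finset.sum_le_sum fun i _ => hflip i x y)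
    rw [Finset.sum_const, Finset.card_univ, Fintype.card_fin, nsmul_eq_mul] at h1
    calc _ ≤ (1 / n : ℝ) * (n * (R * ‖x - y‖)) := mul_le_mul_of_nonneg_left h1 (by positivity)
      _ = _ := by field_simp
  have hmain := det_lemma Θ B hB R ρ L (2 * R / ρ) (L * B) hR hρ hL (by positivity) (by positivity)
    (fun t => w (t+1)) (fun t => hw0 _) (fun t => hw1 _) (fun t ht => hwlt _ (by omega)) hww' hwd'
    θ hθΘ hΔ h H h0 hz (fun t => (hgrad t).1) (fun t => (hgrad t).2) H0 HS fbar e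
    (fun t => (R + M) * ∑ i, |D t i|) hfl
    (fun t => mul_nonneg (by linarith) (Finset.sum_nonneg fun i _ => abs_nonneg _))
    (by
      have h1 : Tendsto (fun t => ∑ i, |D t i|) atTop (𝓝 (∑ i : Fin n, (0:ℝ))) :=
        tendsto_finsetSum _ (fun i _ => hDa i)
      have h2 := h1.const_mul (R + M)
      simpa using h2)
    (by
      have h1 : Summable (fun t => ∑ i, w t * |D t i|) := summable_sum (fun i _ => hD i)
      have h2 := ((summable_nat_add_iff 1).2 h1).mul_left (R + M)
      refine h2.congr (fun t => ?_)
      rw [← Finset.mul_sum]; ring)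
    (by
      intro t x hx
      refine (Finset.abs_sum_le_sum_abs _ _).trans ?_
      rw [Finset.mul_sum]
      refine Finset.sum_le_sum fun i _ => ?_
      rw [abs_mul, mul_comm]
      apply mul_le_mul_of_nonneg_right _ (abs_nonneg _)
      linarith [hfM i x hx])
    (by
      intro t x y
      simp only [he]
      rw [← Finset.sum_sub_distrib]
      refine (Finset.abs_sum_le_sum_abs _ _).trans ?_
      rw [Finset.mul_sum, Finset.sum_mul]
      refine Finset.sum_le_sum fun i _ => ?_
      rw [← mul_sub, abs_mul]
      have h1 := mul_le_mul_of_nonneg_left (hflip i x y) (abs_nonneg (D t i))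
      have h2 : 0 ≤ M * |D t i| * ‖x - y‖ := by positivity
      nlinarith)
    hmin'
  refine ⟨hmain.1, ?_⟩
  intro θl hcl x hx d hd
  have hfc : Continuous fbar := by
    have : LipschitzWith (Real.toNNReal R) fbar := by
      apply LipschitzWith.of_dist_le_mul
      intro a b
      rw [Real.dist_eq, dist_eq_norm, Real.coe_toNNReal _ hR.le]
      exact hfl a b
    exact this.continuous
  have hθl : θl ∈ Θ := by
    by_contra hc
    have h1 := hΘcomp.isClosed.isOpen_compl.mem_nhds hc
    have h2 := hcl.frequently h1
    obtain ⟨t, ht⟩ := h2.exists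
    exact ht (hθΘ t)
  have hkey : ∀ y ∈ Θ, fbar θl ≤ fbar y + 2 * L * ‖y - θl‖ ^ 2 := by
    intro y hy
    apply le_of_forall_pos_le_add
    intro ε hε
    by_contra hc
    have hcl2 : IsOpen {p | fbar y + 2 * L * ‖y - p‖ ^ 2 + ε < fbar p} :=
      isOpen_lt (by fun_prop) hfc
    have h2 := hcl.frequently (hcl2.mem_nhds (not_le.1 hc))
    obtain ⟨t, ht1, ht2⟩ := (h2.and_eventually (hmain.2 ε hε)).exists
    exact absurd (ht2 y hy) (not_le.2 ht1)
  have hlim : Tendsto (fun s : ℝ => -(2 * L * ‖x - θl‖ ^ 2) * s) (nhdsWithin 0 (Set.Ioi 0))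
      (𝓝 (-(2 * L * ‖x - θl‖ ^ 2) * 0)) := by
    apply Filter.Tendsto.mono_left _ nhdsWithin_le_nhds
    exact (by fun_prop : Continuous (fun s : ℝ => -(2 * L * ‖x - θl‖ ^ 2) * s)).tendsto 0
  rw [mul_zero] at hlim
  refine le_of_tendsto_of_tendsto hlim hd ?_
  filter_upwards [Ioo_mem_nhdsGT (show (0:ℝ) < 1 by norm_num)] with s hs
  rw [le_div_iff₀ hs.1]
  have h1 : θl + s • (x - θl) ∈ Θ := hΘconv.add_smul_sub_mem hθl hx ⟨hs.1.le, hs.2.le⟩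
  have h2 := hkey _ h1
  rw [add_sub_cancel_left, norm_smul, Real.norm_of_nonneg hs.1.le] at h2
  nlinarith

/-- Convergence of stochastic majorization-minimization (SMM): almost surely, the empirical
risk values converge and every limit point of the iterates is a stationary point of the
empirical risk over `Θ`. -/
theorem smm_convergence
    {K n P : ℕ} (hn : 1 ≤ n)
    (Θ : Set (EuclideanSpace ℝ (Fin K)))
    (hΘne : Θ.Nonempty) (hΘcomp : IsCompact Θ) (hΘconv : Convex ℝ Θ)
    (R ρ L : ℝ) (hR : 0 < R) (hρ : 0 < ρ) (hL : 0 < L)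
    (f : Fin n → EuclideanSpace ℝ (Fin K) → ℝ)
    (hflip : ∀ i, ∀ x y : EuclideanSpace ℝ (Fin K), |f i x - f i y| ≤ R * ‖x - y‖)
    (hfbdd : ∃ M, ∀ i, ∀ x ∈ Θ, |f i x| ≤ M)
    (fbar : EuclideanSpace ℝ (Fin K) → ℝ)
    (hfbar : ∀ x, fbar x = (1 / n : ℝ) * ∑ i, f i x)
    (hdd : ∀ i, ∀ θ θ' : EuclideanSpace ℝ (Fin K), ∃ d, HasDirDeriv (f i) θ (θ' - θ) d)
    (hddbar : ∀ θ θ' : EuclideanSpace ℝ (Fin K), ∃ d, HasDirDeriv fbar θ (θ' - θ) d)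
    (u : ℝ) (hu : 3 / 4 < u) (hu1 : u < 1)
    (w : ℕ → ℝ) (hw : ∀ t, w t = (t : ℝ) ^ (-u))
    {Ω : Type*} {m0 : MeasurableSpace Ω}
    (μpr : Measure Ω) [IsProbabilityMeasure μpr] (F : Filtration ℕ m0)
    (idx : ℕ → Ω → Fin n)
    (hidxmeas : ∀ t, 1 ≤ t → Measurable[F t] (idx t))
    (hidxindep : ∀ t, 1 ≤ t →
      ProbabilityTheory.Indep (MeasurableSpace.comap (idx t) ⊤) (F (t - 1)) μpr)
    (hidxunif : ∀ t, 1 ≤ t → ∀ i, μpr {ω | idx t ω = i} = (n : ENNReal)⁻¹)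
    (K₀ : Set (EuclideanSpace ℝ (Fin P))) (hK₀ : IsCompact K₀)
    (ghat : EuclideanSpace ℝ (Fin P) → EuclideanSpace ℝ (Fin K) → ℝ)
    (hghat : ContinuousOn
      (fun q : EuclideanSpace ℝ (Fin P) × EuclideanSpace ℝ (Fin K) => ghat q.1 q.2)
      (K₀ ×ˢ Set.univ))
    (θ₀ : EuclideanSpace ℝ (Fin K)) (hθ₀ : θ₀ ∈ Θ)
    (g gbar : ℕ → Ω → EuclideanSpace ℝ (Fin K) → ℝ)
    (κ : ℕ → Ω → EuclideanSpace ℝ (Fin P))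
    (θ : ℕ → Ω → EuclideanSpace ℝ (Fin K))
    (hθ0 : ∀ ω, θ 0 ω = θ₀)
    (hθΘ : ∀ t ω, θ t ω ∈ Θ)
    (hgmeas : ∀ t, 1 ≤ t → ∀ x, StronglyMeasurable[F t] (fun ω => g t ω x))
    (hκmeas : ∀ t, 1 ≤ t → StronglyMeasurable[F t] (κ t))
    (hθmeas : ∀ t, StronglyMeasurable[F t] (θ t))
    (hgbar1 : ∀ ω, gbar 1 ω = g 1 ω)
    (hgbarrec : ∀ t, 2 ≤ t → ∀ ω x,
      gbar t ω x = (1 - w t) * gbar (t - 1) ω x + w t * g t ω x)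
    (hsurr : ∀ᵐ ω ∂μpr, ∀ t, 1 ≤ t →
      IsSurrogate Θ ρ L (f (idx t ω)) (g t ω) (θ (t - 1) ω))
    (hparam : ∀ᵐ ω ∂μpr, ∀ t, 1 ≤ t →
      κ t ω ∈ K₀ ∧ ∀ x, gbar t ω x = ghat (κ t ω) x)
    (hmin : ∀ᵐ ω ∂μpr, ∀ t, 1 ≤ t → ∀ x ∈ Θ, gbar t ω (θ t ω) ≤ gbar t ω x) :
    ∀ᵐ ω ∂μpr,
      (∃ l, Filter.Tendsto (fun t => fbar (θ t ω)) Filter.atTop (nhds l)) ∧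
      ∀ θlim : EuclideanSpace ℝ (Fin K),
        MapClusterPt θlim Filter.atTop (fun t => θ t ω) →
        ∀ x ∈ Θ, ∀ d, HasDirDeriv fbar θlim (x - θlim) d → 0 ≤ d := by
  obtain ⟨hw0, hw1, hwz, hwone, hwlt, hwmono, hwm, hwl, hws, hww, hwd⟩ := w_facts u hu hu1 w hw
  have hnpos : (0:ℝ) < n := by exact_mod_cast hn
  have hD : ∀ i : Fin n, ∀ᵐ ω ∂μpr, Summable (fun t => w t *
      |dseq w (fun s => (if idx (s+1) ω = i then (1:ℝ) else 0) - 1 / n) t|) := by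
    intro i
    have hmeasF : ∀ t, Measurable[MeasurableSpace.comap (idx (t+1)) ⊤]
        (fun ω => (if idx (t+1) ω = i then (1:ℝ) else 0) - 1 / n) := by
      intro t
      have h1 : Measurable[⊤] (fun j : Fin n => (if j = i then (1:ℝ) else 0) - 1 / n) :=
        measurable_from_top
      exact h1.comp (comap_measurable (m := ⊤) (idx (t+1)))
    have hle : ∀ t, MeasurableSpace.comap (idx (t+1)) ⊤ ≤ F (t+1) := fun t =>
      (hidxmeas (t+1) (by omega)).comap_le
    apply prob_lemma μpr F w hw0 hw1 hwone hwm hwl hws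
      (fun s ω => (if idx (s+1) ω = i then (1:ℝ) else 0) - 1 / n)
      _ _ _ _ (fun t ω => dseq w (fun s => (if idx (s+1) ω = i then (1:ℝ) else 0) - 1 / n) t)
      (fun _ => rfl) (fun _ _ => rfl)
    · intro t ω
      have h1 : (1:ℝ) / n ≤ 1 := by rw [div_le_one hnpos]; exact_mod_cast hn
      have h2 : (0:ℝ) ≤ 1 / n := by positivity
      rw [abs_le]
      split_ifs <;> constructor <;> linarith
    · intro t
      exact (hmeasF t).mono (hle t) le_rfl
    · intro t
      have hset : MeasurableSet {ω | idx (t+1) ω = i} := by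
        apply (F.le (t+1)) _
        exact hle t _ ⟨{i}, trivial, rfl⟩
      have e1 : (fun ω => (if idx (t+1) ω = i then (1:ℝ) else 0)) =
          Set.indicator {ω | idx (t+1) ω = i} (fun _ => (1:ℝ)) := by
        funext ω; simp [Set.indicator_apply]
      rw [integral_sub, e1, integral_indicator hset]
      · simp [measureReal_def, hidxunif (t+1) (by omega) i]
      · rw [e1]; exact (integrable_const _).indicator hset
      · exact integrable_const _
    · intro t
      exact ProbabilityTheory.indep_of_indep_of_le_left (hidxindep (t+1) (by omega))
        (hmeasF t).comap_le
  filter_upwards [ae_all_iff.2 hD, hsurr, hmin] with ω h1 h2 h3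
  exact path_lemma hn Θ hΘcomp hΘconv R ρ L hR hρ hL f hflip hfbdd fbar hfbar w hw0 hw1 hwz hwone
    hwlt hwmono hww hwd (fun t => idx t ω) (fun t => g t ω) (fun t => gbar t ω) (fun t => θ t ω)
    (fun t => hθΘ t ω) (hgbar1 ω) (fun t ht x => hgbarrec t ht ω x) h2 h3 h1
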